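/- arXiv:1907.02123 — 2 statements merged into one kernel-verified Lean document; each statement's English description precedes it below -/
import Mathlib

section
/- A pair (t, λ) ∈ (0,∞) × (0,∞) satisfies the system φ_λ(t) = 0 and φ_λ′(t) = 0 if and only if λ = λ₀ := (γ/q)·((q−p)/(γ−p))·((p/q)·(γ−q)/(γ−p))^{(γ−q)/(q−p)} · c^{(γ−p)/(q−p)} / (b · a^{(γ−q)/(q−p)}) and t = t₀ := ((1/λ₀)·(γ/q)·((q−p)/(γ−p))·(c/b))^{1/(γ−q)}. -/
open Filter Topology Set

noncomputable def phiF (p q γ a b c lam : ℝ) : ℝ → ℝ := fun t =>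
  (a / p) * t ^ p + (lam * b / γ) * t ^ γ - (c / q) * t ^ q

noncomputable def lamZeroC (p q γ a b c : ℝ) : ℝ :=
  (γ / q) * ((q - p) / (γ - p)) * ((p / q) * ((γ - q) / (γ - p))) ^ ((γ - q) / (q - p)) *
    c ^ ((γ - p) / (q - p)) / (b * a ^ ((γ - q) / (q - p)))

noncomputable def tZeroC (p q γ a b c : ℝ) : ℝ :=
  ((1 / lamZeroC p q γ a b c) * (γ / q) * ((q - p) / (γ - p)) * (c / b)) ^ (1 / (γ - q))

theorem hasDerivAt_phiF {p q γ : ℝ} (a b c lam : ℝ) (hp : p ≠ 0) (hq : q ≠ 0) (hγ : γ ≠ 0)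
    {t : ℝ} (ht : 0 < t) :
    HasDerivAt (phiF p q γ a b c lam)
      ((a * t ^ p + lam * b * t ^ γ - c * t ^ q) / t) t := by
  have h := (((Real.hasDerivAt_rpow_const (p := p) (Or.inl ht.ne')).const_mul (a / p)).add
    ((Real.hasDerivAt_rpow_const (p := γ) (Or.inl ht.ne')).const_mul (lam * b / γ))).sub
    ((Real.hasDerivAt_rpow_const (p := q) (Or.inl ht.ne')).const_mul (c / q))
  refine h.congr_deriv ?_
  rw [Real.rpow_sub_one ht.ne', Real.rpow_sub_one ht.ne', Real.rpow_sub_one ht.ne']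
  field_simp

theorem weighted_balance_iff {p q γ A B C : ℝ} (hp : 0 < p) (hpq : p < q) (hqγ : q < γ) :
    (A / p + B / γ - C / q = 0 ∧ A + B - C = 0) ↔
      (A = C * ((p / q) * ((γ - q) / (γ - p))) ∧ B = C * ((γ / q) * ((q - p) / (γ - p)))) := by
  have hq : 0 < q := hp.trans hpq
  have hγ : 0 < γ := hq.trans hqγ
  have hγp : γ - p ≠ 0 := by linarith
  constructor
  · rintro ⟨h₁, h₂⟩
    obtain rfl : B = C - A := by linarith
    field_simp at h₁ ⊢
    constructor <;> linarith
  · rintro ⟨rfl, rfl⟩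
    constructor <;> field_simp <;> ring

theorem phiF_double_zero_iff {p q γ a b c lam t : ℝ} (hp : 0 < p) (hpq : p < q) (hqγ : q < γ)
    (hb : 0 < b) (hc : 0 < c) (ht : 0 < t) :
    (phiF p q γ a b c lam t = 0 ∧ deriv (phiF p q γ a b c lam) t = 0) ↔
      (t ^ (q - p) = a / (c * ((p / q) * ((γ - q) / (γ - p)))) ∧
        lam * t ^ (γ - q) = (γ / q) * ((q - p) / (γ - p)) * (c / b)) := by
  have hq : 0 < q := hp.trans hpq
  have hγ : 0 < γ := hq.trans hqγ
  have hγq : 0 < γ - q := sub_pos.2 hqγ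
  have hγp : 0 < γ - p := sub_pos.2 (hpq.trans hqγ)
  have htp : 0 < t ^ p := Real.rpow_pos_of_pos ht p
  have htq : 0 < t ^ q := Real.rpow_pos_of_pos ht q
  have hphi : phiF p q γ a b c lam t =
      a * t ^ p / p + lam * b * t ^ γ / γ - c * t ^ q / q := by
    unfold phiF
    ring
  rw [(hasDerivAt_phiF a b c lam hp.ne' hq.ne' hγ.ne' ht).deriv, hphi,
    div_eq_zero_iff, or_iff_left ht.ne', weighted_balance_iff hp hpq hqγ,
    Real.rpow_sub ht, Real.rpow_sub ht]
  generalize hK : (p / q) * ((γ - q) / (γ - p)) = K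
  generalize (γ / q) * ((q - p) / (γ - p)) = M
  have hK0 : 0 < K := hK ▸ by positivity
  refine and_congr ?_ ?_
  · rw [div_eq_div_iff htp.ne' (by positivity)]
    constructor <;> intro h <;> linarith
  · rw [← mul_div_assoc, ← mul_div_assoc, div_eq_div_iff htq.ne' hb.ne']
    constructor <;> intro h <;> linarith

theorem lamZeroC_eq_div {p q γ a b c : ℝ} (hp : 0 < p) (hpq : p < q) (hqγ : q < γ)
    (ha : 0 < a) (hc : 0 < c) :
    lamZeroC p q γ a b c = (γ / q) * ((q - p) / (γ - p)) * (c / b) /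
      (a / (c * ((p / q) * ((γ - q) / (γ - p))))) ^ ((γ - q) / (q - p)) := by
  have hq : 0 < q := hp.trans hpq
  have hqp : 0 < q - p := sub_pos.2 hpq
  have hγq : 0 < γ - q := sub_pos.2 hqγ
  have hγp : 0 < γ - p := sub_pos.2 (hpq.trans hqγ)
  have hexp : (γ - p) / (q - p) = (γ - q) / (q - p) + 1 := by
    field_simp
    ring
  unfold lamZeroC
  rw [hexp, Real.rpow_add_one hc.ne']
  generalize hK : (p / q) * ((γ - q) / (γ - p)) = K
  generalize (γ / q) * ((q - p) / (γ - p)) = M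
  have hK0 : 0 < K := hK ▸ by positivity
  rw [Real.div_rpow ha.le (by positivity), Real.mul_rpow hc.le hK0.le, div_div_eq_mul_div,
    mul_div_assoc' M c b, div_mul_eq_mul_div, div_div]
  ring

theorem stmt8 (p q γ a b c : ℝ)
    (hp : 1 < p) (hpq : p < q) (hqγ : q < γ)
    (ha : 0 < a) (hb : 0 < b) (hc : 0 < c) :
    ∀ t lam : ℝ, 0 < t → 0 < lam →
      ((phiF p q γ a b c lam t = 0 ∧ deriv (phiF p q γ a b c lam) t = 0) ↔
        (lam = lamZeroC p q γ a b c ∧ t = tZeroC p q γ a b c)) := by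
  intro t lam ht _
  have hp0 : 0 < p := one_pos.trans hp
  have hq : 0 < q := hp0.trans hpq
  have hγ : 0 < γ := hq.trans hqγ
  have hqp : 0 < q - p := sub_pos.2 hpq
  have hγq : 0 < γ - q := sub_pos.2 hqγ
  have hγp : 0 < γ - p := sub_pos.2 (hpq.trans hqγ)
  rw [phiF_double_zero_iff hp0 hpq hqγ hb hc ht]
  have hlam := lamZeroC_eq_div (b := b) hp0 hpq hqγ ha hc
  set S := a / (c * ((p / q) * ((γ - q) / (γ - p)))) with hS
  set N := (γ / q) * ((q - p) / (γ - p)) * (c / b) with hN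
  set R := S ^ ((γ - q) / (q - p)) with hR
  have hS0 : 0 < S := by positivity
  have hN0 : 0 < N := by positivity
  have hR0 : 0 < R := by positivity
  have hS_iff : t ^ (q - p) = S ↔ t ^ (γ - q) = R := by
    rw [← Real.eq_rpow_inv ht.le hS0.le hqp.ne', ← Real.eq_rpow_inv ht.le hR0.le hγq.ne', hR,
      ← Real.rpow_mul hS0.le, div_mul_eq_mul_div, mul_inv_cancel₀ hγq.ne', one_div]
  have ht_iff : t = tZeroC p q γ a b c ↔ t ^ (γ - q) = R := by
    have hbase : 1 / lamZeroC p q γ a b c * (γ / q) * ((q - p) / (γ - p)) * (c / b) = R := by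
      rw [mul_assoc, mul_assoc, ← mul_assoc (γ / q), ← hN, hlam]
      field_simp
    rw [tZeroC, hbase, one_div, Real.eq_rpow_inv ht.le hR0.le hγq.ne']
  rw [hS_iff, ht_iff, hlam, and_comm]
  refine and_congr_left fun h => ?_
  rw [h, eq_div_iff hR0.ne']
end

section
/- Let λ_c := ((q−p)/(γ−p))·((γ−q)/(γ−p))^{(γ−q)/(q−p)} · c^{(γ−p)/(q−p)} / (b · a^{(γ−q)/(q−p)}) and t_c := ((1/λ_c)·((q−p)/(γ−p))·(c/b))^{1/(γ−q)}. Then a pair (t, λ) ∈ (0,∞) × (0,∞) satisfies the system φ_λ′(t) = 0 and φ_λ″(t) = 0 if and only if (t, λ) = (t_c, λ_c). Moreover, if 0 < λ < λ_c then φ_λ′ has exactly two zeros 0 < t⁻ < t⁺ in (0,∞), with φ_λ″(t⁻) < 0 and φ_λ″(t⁺) > 0, and if λ > λ_c then φ_λ′(t) > 0 for all t > 0. -/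
open Filter Topology Set

noncomputable def lamCrit (p q γ a b c : ℝ) : ℝ :=
  ((q - p) / (γ - p)) * ((γ - q) / (γ - p)) ^ ((γ - q) / (q - p)) *
    c ^ ((γ - p) / (q - p)) / (b * a ^ ((γ - q) / (q - p)))

noncomputable def tCrit (p q γ a b c : ℝ) : ℝ :=
  ((1 / lamCrit p q γ a b c) * ((q - p) / (γ - p)) * (c / b)) ^ (1 / (γ - q))

/-- The value of `lam` for which `t` is a critical point of `phiF p q γ a b c lam`. -/
noncomputable def levelF (p q γ a b c : ℝ) : ℝ → ℝ := fun t =>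
  (c * t ^ (q - γ) - a * t ^ (p - γ)) / b

/-- The point at which `levelF` attains its maximum on the positive half-line. -/
noncomputable def peakF (p q γ a c : ℝ) : ℝ :=
  ((γ - p) * a / ((γ - q) * c)) ^ (1 / (q - p))

section

variable {p q γ a b c : ℝ}

lemma peakF_pos (hpq : p < q) (hqγ : q < γ) (ha : 0 < a) (hc : 0 < c) :
    0 < peakF p q γ a c := by
  have h1 : 0 < γ - p := by linarith
  have h2 : 0 < γ - q := by linarith
  unfold peakF
  positivity

lemma peakF_rpow (hpq : p < q) (hqγ : q < γ) (ha : 0 < a) (hc : 0 < c) :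
    peakF p q γ a c ^ (q - p) = (γ - p) * a / ((γ - q) * c) := by
  have h1 : 0 < γ - p := by linarith
  have h2 : 0 < γ - q := by linarith
  have h3 : q - p ≠ 0 := by linarith
  unfold peakF
  rw [← Real.rpow_mul (by positivity), one_div_mul_cancel h3, Real.rpow_one]

lemma hasDerivAt_levelF (hpq : p < q) (hqγ : q < γ) (ha : 0 < a) (hc : 0 < c)
    {t : ℝ} (ht : 0 < t) :
    HasDerivAt (levelF p q γ a b c)
      (t ^ (p - γ - 1) / b * ((γ - q) * c) * (peakF p q γ a c ^ (q - p) - t ^ (q - p))) t := by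
  have h := (((Real.hasDerivAt_rpow_const (p := q - γ) (Or.inl ht.ne')).const_mul c).sub
    ((Real.hasDerivAt_rpow_const (p := p - γ) (Or.inl ht.ne')).const_mul a)).div_const b
  refine h.congr_deriv ?_
  have h2 : γ - q ≠ 0 := by linarith
  rw [peakF_rpow hpq hqγ ha hc,
    show q - γ - 1 = (p - γ - 1) + (q - p) by ring, Real.rpow_add ht]
  field_simp
  ring

lemma strictMonoOn_levelF (hpq : p < q) (hqγ : q < γ) (ha : 0 < a) (hb : 0 < b) (hc : 0 < c) :
    StrictMonoOn (levelF p q γ a b c) (Ioc 0 (peakF p q γ a c)) := by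
  refine strictMonoOn_of_deriv_pos (convex_Ioc _ _)
    (fun t ht => (hasDerivAt_levelF hpq hqγ ha hc ht.1).continuousAt.continuousWithinAt) ?_
  intro t ht
  rw [interior_Ioc] at ht
  have h0 := ht.1
  have h1 := Real.rpow_lt_rpow ht.1.le ht.2 (sub_pos.2 hpq)
  have h2 := sub_pos.2 hqγ
  have h3 := sub_pos.2 h1
  rw [(hasDerivAt_levelF hpq hqγ ha hc ht.1).deriv]
  positivity

lemma strictAntiOn_levelF (hpq : p < q) (hqγ : q < γ) (ha : 0 < a) (hb : 0 < b) (hc : 0 < c) :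
    StrictAntiOn (levelF p q γ a b c) (Ici (peakF p q γ a c)) := by
  have hP := peakF_pos hpq hqγ ha hc
  refine strictAntiOn_of_deriv_neg (convex_Ici _)
    (fun t ht => (hasDerivAt_levelF hpq hqγ ha hc
      (hP.trans_le ht)).continuousAt.continuousWithinAt) ?_
  intro t ht
  rw [interior_Ici] at ht
  have h0 : 0 < t := hP.trans ht
  have h1 := Real.rpow_lt_rpow hP.le ht (sub_pos.2 hpq)
  have h2 := sub_pos.2 hqγ
  rw [(hasDerivAt_levelF hpq hqγ ha hc h0).deriv]
  exact mul_neg_of_pos_of_neg (by positivity) (sub_neg.2 h1)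

lemma levelF_peakF (hpq : p < q) (hqγ : q < γ) (ha : 0 < a) (hc : 0 < c) :
    levelF p q γ a b c (peakF p q γ a c) =
      (q - p) / (γ - p) * (c / b) * peakF p q γ a c ^ (q - γ) := by
  have hP := peakF_pos hpq hqγ ha hc
  have h1 : γ - p ≠ 0 := by linarith
  have h2 : γ - q ≠ 0 := by linarith
  unfold levelF
  rw [show p - γ = (q - γ) - (q - p) by ring, Real.rpow_sub hP (q - γ) (q - p),
    peakF_rpow hpq hqγ ha hc]
  field_simp
  ring

lemma lamCrit_eq (hpq : p < q) (hqγ : q < γ) (ha : 0 < a) (hc : 0 < c) :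
    lamCrit p q γ a b c = levelF p q γ a b c (peakF p q γ a c) := by
  have h1 : 0 < γ - p := by linarith
  have h2 : 0 < γ - q := by linarith
  have h3 : q - p ≠ 0 := by linarith
  rw [levelF_peakF hpq hqγ ha hc]
  unfold lamCrit peakF
  rw [← Real.rpow_mul (by positivity),
    show 1 / (q - p) * (q - γ) = -((γ - q) / (q - p)) by ring,
    Real.rpow_neg (by positivity), ← Real.inv_rpow (by positivity),
    show ((γ - p) * a / ((γ - q) * c))⁻¹ = (γ - q) / (γ - p) * c / a by field_simp,
    Real.div_rpow (by positivity) ha.le, Real.mul_rpow (by positivity) hc.le,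
    show (γ - p) / (q - p) = 1 + (γ - q) / (q - p) by field_simp; ring,
    Real.rpow_add hc, Real.rpow_one]
  ring

lemma tCrit_eq (hpq : p < q) (hqγ : q < γ) (ha : 0 < a) (hb : 0 < b) (hc : 0 < c) :
    tCrit p q γ a b c = peakF p q γ a c := by
  have hP := peakF_pos hpq hqγ ha hc
  have h1 : γ - p ≠ 0 := by linarith
  have h2 : γ - q ≠ 0 := by linarith
  have h3 : q - p ≠ 0 := by linarith
  have key : 1 / lamCrit p q γ a b c * ((q - p) / (γ - p)) * (c / b) =
      peakF p q γ a c ^ (γ - q) := by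
    rw [lamCrit_eq hpq hqγ ha hc, levelF_peakF hpq hqγ ha hc,
      show q - γ = -(γ - q) by ring, Real.rpow_neg hP.le]
    field_simp
  rw [tCrit, key, ← Real.rpow_mul hP.le, mul_one_div_cancel h2, Real.rpow_one]

lemma levelF_le_lamCrit (hpq : p < q) (hqγ : q < γ) (ha : 0 < a) (hb : 0 < b) (hc : 0 < c)
    {t : ℝ} (ht : 0 < t) : levelF p q γ a b c t ≤ lamCrit p q γ a b c := by
  have hP := peakF_pos hpq hqγ ha hc
  rw [lamCrit_eq hpq hqγ ha hc]
  rcases le_total t (peakF p q γ a c) with h | h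
  · exact (strictMonoOn_levelF hpq hqγ ha hb hc).monotoneOn ⟨ht, h⟩ ⟨hP, le_rfl⟩ h
  · exact (strictAntiOn_levelF hpq hqγ ha hb hc).antitoneOn self_mem_Ici h h

lemma deriv_phiF (hp : p ≠ 0) (hq : q ≠ 0) (hγ : γ ≠ 0) (hb : b ≠ 0) (lam : ℝ)
    {t : ℝ} (ht : 0 < t) :
    deriv (phiF p q γ a b c lam) t = b * t ^ (γ - 1) * (lam - levelF p q γ a b c t) := by
  have h := (((Real.hasDerivAt_rpow_const (p := p) (Or.inl ht.ne')).const_mul (a / p)).add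
    ((Real.hasDerivAt_rpow_const (p := γ) (Or.inl ht.ne')).const_mul (lam * b / γ))).sub
    ((Real.hasDerivAt_rpow_const (p := q) (Or.inl ht.ne')).const_mul (c / q))
  refine Eq.trans (HasDerivAt.deriv h) ?_
  unfold levelF
  rw [show p - 1 = (γ - 1) + (p - γ) by ring, show q - 1 = (γ - 1) + (q - γ) by ring,
    Real.rpow_add ht, Real.rpow_add ht]
  field_simp
  ring

lemma deriv_phiF_eq_zero_iff (hp : p ≠ 0) (hq : q ≠ 0) (hγ : γ ≠ 0) (hb : b ≠ 0) {lam t : ℝ}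
    (ht : 0 < t) : deriv (phiF p q γ a b c lam) t = 0 ↔ levelF p q γ a b c t = lam := by
  have h := (Real.rpow_pos_of_pos ht (γ - 1)).ne'
  rw [deriv_phiF hp hq hγ hb lam ht, mul_eq_zero_iff_left (mul_ne_zero hb h), sub_eq_zero, eq_comm]

lemma deriv_deriv_phiF (hp : 0 < p) (hpq : p < q) (hqγ : q < γ) (ha : 0 < a) (hb : 0 < b)
    (hc : 0 < c) {lam t : ℝ} (ht : 0 < t) (hlam : levelF p q γ a b c t = lam) :
    deriv (deriv (phiF p q γ a b c lam)) t =
      t ^ (p - 2) * ((γ - q) * c) * (t ^ (q - p) - peakF p q γ a c ^ (q - p)) := by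
  have hev : deriv (phiF p q γ a b c lam) =ᶠ[𝓝 t]
      fun x => b * x ^ (γ - 1) * (lam - levelF p q γ a b c x) := by
    filter_upwards [lt_mem_nhds ht] with x hx
    exact deriv_phiF hp.ne' (hp.trans hpq).ne' (hp.trans (hpq.trans hqγ)).ne' hb.ne' lam hx
  have h := ((Real.hasDerivAt_rpow_const (p := γ - 1) (Or.inl ht.ne')).const_mul b).mul
    ((hasDerivAt_levelF (b := b) hpq hqγ ha hc ht).const_sub lam)
  rw [hev.deriv_eq]
  refine Eq.trans (HasDerivAt.deriv h) ?_
  rw [hlam, show p - 2 = (γ - 1) + (p - γ - 1) by ring, Real.rpow_add ht]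
  field_simp
  ring

lemma exists_levelF_eq_lt_peakF (hpq : p < q) (hqγ : q < γ) (ha : 0 < a) (hc : 0 < c)
    {lam : ℝ} (hlam : 0 < lam) (hlt : lam < lamCrit p q γ a b c) :
    ∃ t, 0 < t ∧ t < peakF p q γ a c ∧ levelF p q γ a b c t = lam := by
  have hr : 0 < q - p := sub_pos.2 hpq
  have hs : 0 < γ - q := sub_pos.2 hqγ
  have hP := peakF_pos hpq hqγ ha hc
  set s := (a / c) ^ (1 / (q - p)) with hs_def
  have hs0 : 0 < s := by positivity
  have hsr : s ^ (q - p) = a / c := by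
    rw [hs_def, ← Real.rpow_mul (by positivity), one_div_mul_cancel hr.ne', Real.rpow_one]
  have hsP : s < peakF p q γ a c := by
    refine (Real.rpow_lt_rpow_iff hs0.le hP.le hr).1 ?_
    rw [hsr, peakF_rpow hpq hqγ ha hc, div_lt_div_iff₀ hc (by positivity)]
    nlinarith [mul_pos (mul_pos ha hc) hr]
  have hzero : levelF p q γ a b c s = 0 := by
    unfold levelF
    rw [show q - γ = (p - γ) + (q - p) by ring, Real.rpow_add hs0, hsr]
    field_simp
    ring
  rw [lamCrit_eq hpq hqγ ha hc] at hlt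
  obtain ⟨t, ht, rfl⟩ := intermediate_value_Ioo hsP.le
    (fun t ht => (hasDerivAt_levelF (b := b) hpq hqγ ha hc
      (hs0.trans_le ht.1)).continuousAt.continuousWithinAt) ⟨hzero.trans_lt hlam, hlt⟩
  exact ⟨t, hs0.trans ht.1, ht.2, rfl⟩

lemma exists_levelF_eq_gt_peakF (hpq : p < q) (hqγ : q < γ) (ha : 0 < a) (hc : 0 < c)
    {lam : ℝ} (hlam : 0 < lam) (hlt : lam < lamCrit p q γ a b c) :
    ∃ t, peakF p q γ a c < t ∧ levelF p q γ a b c t = lam := by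
  have hP := peakF_pos hpq hqγ ha hc
  have hlim : Tendsto (levelF p q γ a b c) atTop (𝓝 0) := by
    have h1 := tendsto_rpow_neg_atTop (sub_pos.2 hqγ)
    have h2 := tendsto_rpow_neg_atTop (sub_pos.2 (hpq.trans hqγ))
    rw [neg_sub] at h1 h2
    have h := ((h1.const_mul c).sub (h2.const_mul a)).div_const b
    rwa [mul_zero, mul_zero, sub_zero, zero_div] at h
  obtain ⟨u, hu, hPu⟩ :=
    ((hlim.eventually_lt_const hlam).and (eventually_ge_atTop (peakF p q γ a c))).exists
  rw [lamCrit_eq hpq hqγ ha hc] at hlt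
  obtain ⟨t, ht, rfl⟩ := intermediate_value_Ioo' hPu
    (fun t ht => (hasDerivAt_levelF (b := b) hpq hqγ ha hc
      (hP.trans_le ht.1)).continuousAt.continuousWithinAt) ⟨hu, hlt⟩
  exact ⟨t, ht.1, rfl⟩

end

theorem stmt13 (p q γ a b c : ℝ)
    (hp : 1 < p) (hpq : p < q) (hqγ : q < γ)
    (ha : 0 < a) (hb : 0 < b) (hc : 0 < c) :
    (∀ t lam : ℝ, 0 < t → 0 < lam →
      ((deriv (phiF p q γ a b c lam) t = 0 ∧
          deriv (deriv (phiF p q γ a b c lam)) t = 0) ↔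
        (t = tCrit p q γ a b c ∧ lam = lamCrit p q γ a b c))) ∧
    (∀ lam : ℝ, 0 < lam → lam < lamCrit p q γ a b c →
      ∃ t1 t2 : ℝ, 0 < t1 ∧ t1 < t2 ∧
        deriv (phiF p q γ a b c lam) t1 = 0 ∧ deriv (phiF p q γ a b c lam) t2 = 0 ∧
        (∀ t : ℝ, 0 < t → deriv (phiF p q γ a b c lam) t = 0 → t = t1 ∨ t = t2) ∧
        deriv (deriv (phiF p q γ a b c lam)) t1 < 0 ∧
        0 < deriv (deriv (phiF p q γ a b c lam)) t2) ∧
    (∀ lam : ℝ, lamCrit p q γ a b c < lam →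
      ∀ t : ℝ, 0 < t → 0 < deriv (phiF p q γ a b c lam) t) := by
  have hp0 : 0 < p := by linarith
  have hq0 : 0 < q := by linarith
  have hγ0 : 0 < γ := by linarith
  have hr : 0 < q - p := sub_pos.2 hpq
  have hs : 0 < γ - q := sub_pos.2 hqγ
  have hP := peakF_pos hpq hqγ ha hc
  have hzero : ∀ {lam t : ℝ}, 0 < t →
      (deriv (phiF p q γ a b c lam) t = 0 ↔ levelF p q γ a b c t = lam) :=
    fun ht => deriv_phiF_eq_zero_iff hp0.ne' hq0.ne' hγ0.ne' hb.ne' ht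
  refine ⟨fun t lam ht _ => ?_, fun lam hlam hlt => ?_, fun lam hlt t ht => ?_⟩
  · rw [hzero ht, tCrit_eq hpq hqγ ha hb hc, lamCrit_eq hpq hqγ ha hc]
    constructor
    · rintro ⟨h1, h2⟩
      rw [deriv_deriv_phiF hp0 hpq hqγ ha hb hc ht h1,
        mul_eq_zero_iff_left (by positivity), sub_eq_zero,
        Real.rpow_left_inj ht.le hP.le hr.ne'] at h2
      exact ⟨h2, by rw [← h1, h2]⟩
    · rintro ⟨rfl, rfl⟩
      refine ⟨rfl, ?_⟩
      rw [deriv_deriv_phiF hp0 hpq hqγ ha hb hc ht rfl, sub_self, mul_zero]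
  · obtain ⟨t1, ht1, ht1P, h1⟩ := exists_levelF_eq_lt_peakF hpq hqγ ha hc hlam hlt
    obtain ⟨t2, ht2P, h2⟩ := exists_levelF_eq_gt_peakF hpq hqγ ha hc hlam hlt
    have ht2 : 0 < t2 := hP.trans ht2P
    refine ⟨t1, t2, ht1, ht1P.trans ht2P, (hzero ht1).2 h1, (hzero ht2).2 h2,
      fun t ht h => ?_, ?_, ?_⟩
    · rw [hzero ht] at h
      rcases le_total t (peakF p q γ a c) with hle | hge
      · exact Or.inl ((strictMonoOn_levelF hpq hqγ ha hb hc).injOn ⟨ht, hle⟩ ⟨ht1, ht1P.le⟩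
          (h.trans h1.symm))
      · exact Or.inr ((strictAntiOn_levelF hpq hqγ ha hb hc).injOn hge ht2P.le
          (h.trans h2.symm))
    · rw [deriv_deriv_phiF hp0 hpq hqγ ha hb hc ht1 h1]
      exact mul_neg_of_pos_of_neg (by positivity)
        (sub_neg.2 (Real.rpow_lt_rpow ht1.le ht1P hr))
    · rw [deriv_deriv_phiF hp0 hpq hqγ ha hb hc ht2 h2]
      exact mul_pos (by positivity) (sub_pos.2 (Real.rpow_lt_rpow hP.le ht2P hr))
  · rw [deriv_phiF hp0.ne' hq0.ne' hγ0.ne' hb.ne' lam ht]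
    have h := sub_pos.2 ((levelF_le_lamCrit hpq hqγ ha hb hc ht).trans_lt hlt)
    positivity
end
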